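/- Define Φ̃(x) = x·ln(ln(x + e)) for x ≥ 0, let C = ln 2 + ln(2e), and for n ∈ ℕ, n ≥ 1, set kₙ = ln(Cn)/n. Then for every n ≥ 1 with ln(Cn) ≥ 1 and every t ≥ 0: Φ̃( (2ⁿ/(kₙ n)) e^{−2ⁿ t} ) ≤ 2ⁿ e^{−2ⁿ t}, i.e. (2ⁿ/ln(Cn)) e^{−2ⁿ t} · ln( ln( (2ⁿ/ln(Cn)) e^{−2ⁿ t} + e ) ) ≤ 2ⁿ e^{−2ⁿ t}. -/

import Mathlib

/-- The Young function `Φ̃(x) = x·ln(ln(x+e))` from the diagonal counterexample. -/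
noncomputable def PhiTilde (x : ℝ) : ℝ := x * Real.log (Real.log (x + Real.exp 1))

/-- The constant `C = ln 2 + ln(2e)`. -/
noncomputable def Ccst : ℝ := Real.log 2 + Real.log (2 * Real.exp 1)

/-- The sequence `kₙ = ln(Cn)/n`. -/
noncomputable def kseq (n : ℕ) : ℝ := Real.log (Ccst * n) / n

/-- The pointwise estimate `Φ̃((2ⁿ/(kₙn)) e^{−2ⁿt}) ≤ 2ⁿ e^{−2ⁿt}` for all `n` with
`kₙ n = ln(Cn) ≥ 1` and all `t ≥ 0`. -/
theorem phiTilde_pointwise_estimate (n : ℕ) (hn : 1 ≤ n)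
    (hln : 1 ≤ Real.log (Ccst * n)) (t : ℝ) (ht : 0 ≤ t) :
    PhiTilde ((2 : ℝ) ^ n / (kseq n * n) * Real.exp (-(2 : ℝ) ^ n * t)) ≤
      (2 : ℝ) ^ n * Real.exp (-(2 : ℝ) ^ n * t) := by
  have hn' : (1 : ℝ) ≤ n := by exact_mod_cast hn
  have hk : kseq n * n = Real.log (Ccst * n) := by
    unfold kseq
    field_simp
  rw [hk]
  set L := Real.log (Ccst * n) with hL
  set E := Real.exp (-(2 : ℝ) ^ n * t)
  have hE0 : 0 < E := Real.exp_pos _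
  have hE1 : E ≤ 1 := Real.exp_le_one_iff.2 (by nlinarith [pow_pos (two_pos (α := ℝ)) n])
  have hp : (1 : ℝ) ≤ 2 ^ n := one_le_pow₀ one_le_two
  have he : 1 < Real.exp 1 := Real.one_lt_exp_iff.2 one_pos
  have hA0 : 0 < 2 ^ n / L * E := by positivity
  have hA : 2 ^ n / L * E ≤ 2 ^ n :=
    (mul_le_of_le_one_right (by positivity) hE1).trans (div_le_self (by positivity) hln)
  have hlog2 : 0 < Real.log (2 * Real.exp 1) := Real.log_pos (by linarith)
  have hlog : Real.log (2 ^ n / L * E + Real.exp 1) ≤ Ccst * n :=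
    calc Real.log (2 ^ n / L * E + Real.exp 1)
        ≤ Real.log (2 ^ n * (2 * Real.exp 1)) := Real.log_le_log (by positivity) (by nlinarith)
      _ = n * Real.log 2 + Real.log (2 * Real.exp 1) := by
        rw [Real.log_mul (by positivity) (by positivity), Real.log_pow]
      _ ≤ Ccst * n := by
        unfold Ccst
        nlinarith
  have hloglog : Real.log (Real.log (2 ^ n / L * E + Real.exp 1)) ≤ L :=
    Real.log_le_log (Real.log_pos (by linarith)) hlog
  calc PhiTilde (2 ^ n / L * E) ≤ 2 ^ n / L * E * L := mul_le_mul_of_nonneg_left hloglog hA0.le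
    _ = 2 ^ n * E := by field_simp
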